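/- Let m ≥ 1 and n ≥ m+2 be integers and let (S_1,…,S_{m+1}) be a partition of V_n = {1,…,n} into m+1 nonempty parts. Then the m-partition hemi-metric α(S_1,…,S_{m+1}) belongs to the cone HMET^m_n, i.e. it satisfies α(S) ≥ 0 for every (m+1)-subset S of V_n and the m-simplex inequality 2·α(T∖{i}) ≤ Σ_{k∈T} α(T∖{k}) for every (m+2)-subset T of V_n and every i ∈ T. -/

import Mathlib

/-- `V n` is the vertex set `{1, …, n}`. -/
def V (n : ℕ) : Finset ℕ := Finset.Icc 1 n

/-- `sigmaT d T = Σ_{k ∈ T} d (T \\ {k})`. -/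
def sigmaT (d : Finset ℕ → ℝ) (T : Finset ℕ) : ℝ := ∑ k ∈ T, d (T.erase k)

/-- Membership in the cone `HMET m n` of `m`-hemi-metrics: nonnegativity on every
`(m+1)`-subset of `V n`, and the `m`-simplex inequalities. -/
def inHMET (m n : ℕ) (d : Finset ℕ → ℝ) : Prop :=
  (∀ S ⊆ V n, S.card = m + 1 → 0 ≤ d S) ∧
  (∀ T ⊆ V n, T.card = m + 2 → ∀ i ∈ T, 2 * d (T.erase i) ≤ sigmaT d T)

/-- The `m`-partition hemi-metric of a partition `P` of `V n` into `m+1` parts: its value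
on an `(m+1)`-subset `S` is `1` if `S` meets every part in exactly one element, and `0`
otherwise. -/
def alphaPartition (m : ℕ) (P : Fin (m + 1) → Finset ℕ) (S : Finset ℕ) : ℝ :=
  if ∀ j, (S ∩ P j).card = 1 then 1 else 0

theorem alphaPartition_nonneg (m : ℕ) (P : Fin (m + 1) → Finset ℕ) (S : Finset ℕ) :
    0 ≤ alphaPartition m P S := by
  unfold alphaPartition
  split_ifs <;> norm_num

/-- Deleting either of two elements of `T` that lie in the same part gives the same value. -/
theorem alphaPartition_erase_eq_of_mem_iff {m : ℕ} {P : Fin (m + 1) → Finset ℕ}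
    {T : Finset ℕ} {i k : ℕ} (hi : i ∈ T) (hk : k ∈ T) (h : ∀ j, i ∈ P j ↔ k ∈ P j) :
    alphaPartition m P (T.erase i) = alphaPartition m P (T.erase k) := by
  have key (j) : (T.erase i ∩ P j).card = (T.erase k ∩ P j).card := by
    simp only [Finset.erase_inter, Finset.card_erase_eq_ite, Finset.mem_inter, hi, hk, h j]
  simp only [alphaPartition, key]

/-- The `m`-partition hemi-metrics belong to the cone `HMET m n`. -/
theorem alphaPartition_mem_HMET (m n : ℕ) (hm : 1 ≤ m) (hn : m + 2 ≤ n)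
    (P : Fin (m + 1) → Finset ℕ)
    (hne : ∀ j, (P j).Nonempty)
    (hdisj : ∀ j k, j ≠ k → Disjoint (P j) (P k))
    (hcover : Finset.univ.biUnion P = V n) :
    inHMET m n (alphaPartition m P) := by
  refine ⟨fun S _ _ => alphaPartition_nonneg m P S, fun T hT _ i hi => ?_⟩
  by_cases hα : ∀ j, (T.erase i ∩ P j).card = 1
  · obtain ⟨j₀, -, hij₀⟩ := Finset.mem_biUnion.1 (hcover ▸ hT hi)
    obtain ⟨k, hk⟩ := Finset.card_pos.1 (by rw [hα j₀]; exact one_pos)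
    obtain ⟨hkTi, hkj₀⟩ := Finset.mem_inter.1 hk
    obtain ⟨hki, hkT⟩ := Finset.mem_erase.1 hkTi
    have hpart (j) : i ∈ P j ↔ k ∈ P j := by
      by_cases hj : j₀ = j
      · subst hj
        exact iff_of_true hij₀ hkj₀
      · exact iff_of_false (Finset.disjoint_left.1 (hdisj _ _ hj) hij₀)
          (Finset.disjoint_left.1 (hdisj _ _ hj) hkj₀)
    calc 2 * alphaPartition m P (T.erase i)
        = alphaPartition m P (T.erase i) + alphaPartition m P (T.erase k) := by
          rw [← alphaPartition_erase_eq_of_mem_iff hi hkT hpart, two_mul]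
      _ = ∑ l ∈ {i, k}, alphaPartition m P (T.erase l) := by rw [Finset.sum_pair hki.symm]
      _ ≤ sigmaT (alphaPartition m P) T :=
          Finset.sum_le_sum_of_subset_of_nonneg
            (Finset.insert_subset hi (Finset.singleton_subset_iff.2 hkT))
            fun l _ _ => alphaPartition_nonneg m P (T.erase l)
  · have h0 : alphaPartition m P (T.erase i) = 0 := if_neg hα
    rw [h0, mul_zero]
    exact Finset.sum_nonneg fun l _ => alphaPartition_nonneg m P (T.erase l)
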